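/- Fix k ∈ ℤ. If ker d'd'' ∩ A^k = (ker d + Im d' + Im d'') ∩ A^k (i.e., the natural map H^k → ⊕_{p+q=k} H_A^{p,q} is surjective), then ker d ∩ (Im d' + Im d'') ∩ A^{k+1} = Im d ∩ A^{k+1} (i.e., the natural map H^{k+1} → ⊕_{p+q=k+1} H_A^{p,q} is injective). -/

import Mathlib

open Submodule

/-- A double complex of complex vector spaces, realized as an internally bigraded
module `W = ⊕_{p,q} A p q` together with global differentials `d'`, `d''` of
bidegrees `(1,0)` and `(0,1)` satisfying `d'∘d' = 0`, `d''∘d'' = 0` and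
`d'∘d'' + d''∘d' = 0`. -/
structure BiComplex (W : Type*) [AddCommGroup W] [Module ℂ W] where
  A : ℤ → ℤ → Submodule ℂ W
  d' : W →ₗ[ℂ] W
  d'' : W →ₗ[ℂ] W
  internal : DirectSum.IsInternal (fun pq : ℤ × ℤ => A pq.1 pq.2)
  map_d' : ∀ p q : ℤ, (A p q).map d' ≤ A (p + 1) q
  map_d'' : ∀ p q : ℤ, (A p q).map d'' ≤ A p (q + 1)
  d'_sq : d' ∘ₗ d' = 0
  d''_sq : d'' ∘ₗ d'' = 0
  anticomm : d' ∘ₗ d'' + d'' ∘ₗ d' = 0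

namespace BiComplex

variable {W : Type*} [AddCommGroup W] [Module ℂ W] (C : BiComplex W)

/-- `ker d' ∩ A^{p,q}` : the kernel of `d' : A^{p,q} → A^{p+1,q}`. -/
def kerd' (p q : ℤ) : Submodule ℂ W := LinearMap.ker C.d' ⊓ C.A p q

/-- `ker d'' ∩ A^{p,q}` : the kernel of `d'' : A^{p,q} → A^{p,q+1}`. -/
def kerd'' (p q : ℤ) : Submodule ℂ W := LinearMap.ker C.d'' ⊓ C.A p q

/-- `Im d' ∩ A^{p,q} = d'(A^{p-1,q})`. -/
def imd' (p q : ℤ) : Submodule ℂ W := (C.A (p - 1) q).map C.d'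

/-- `Im d'' ∩ A^{p,q} = d''(A^{p,q-1})`. -/
def imd'' (p q : ℤ) : Submodule ℂ W := (C.A p (q - 1)).map C.d''

/-- `Im d'd'' ∩ A^{p,q} = (d'∘d'')(A^{p-1,q-1})`. -/
def imd'd'' (p q : ℤ) : Submodule ℂ W := (C.A (p - 1) (q - 1)).map (C.d' ∘ₗ C.d'')

/-- `ker d'd'' ∩ A^{p,q}` : the kernel of `d'∘d'' : A^{p,q} → A^{p+1,q+1}`. -/
def kerd'd'' (p q : ℤ) : Submodule ℂ W := LinearMap.ker (C.d' ∘ₗ C.d'') ⊓ C.A p q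

/-- The `d'd''`-lemma at `(p,q)`:
`Im d' ∩ ker d'' ∩ A^{p,q} = ker d' ∩ Im d'' ∩ A^{p,q} = Im d'd'' ∩ A^{p,q}`. -/
def DDLemmaAt (p q : ℤ) : Prop :=
  C.imd' p q ⊓ C.kerd'' p q = C.imd'd'' p q ∧ C.kerd' p q ⊓ C.imd'' p q = C.imd'd'' p q

/-- The total-degree piece `A^k = ⊕_{p+q=k} A^{p,q}`. -/
def Atot (k : ℤ) : Submodule ℂ W := ⨆ p : ℤ, C.A p (k - p)

/-- The total differential `d = d' + d''`. -/
def dtot : W →ₗ[ℂ] W := C.d' + C.d''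

/-- `ker d ∩ A^k` : the kernel of `d : A^k → A^{k+1}`. -/
def kerdTot (k : ℤ) : Submodule ℂ W := LinearMap.ker C.dtot ⊓ C.Atot k

/-- `Im d ∩ A^k = d(A^{k-1})`. -/
def imdTot (k : ℤ) : Submodule ℂ W := (C.Atot (k - 1)).map C.dtot

/-- `ker d' ∩ ker d'' ∩ A^k = ⊕_{p+q=k} (ker d' ∩ ker d'' ∩ A^{p,q})`. -/
def kerd'kerd''Tot (k : ℤ) : Submodule ℂ W :=
  ⨆ p : ℤ, (C.kerd' p (k - p) ⊓ C.kerd'' p (k - p))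

/-- `Im d'd'' ∩ A^k = ⊕_{p+q=k} (Im d'd'' ∩ A^{p,q})`. -/
def imd'd''Tot (k : ℤ) : Submodule ℂ W := ⨆ p : ℤ, C.imd'd'' p (k - p)

/-- `ker d'd'' ∩ A^k = ⊕_{p+q=k} (ker d'd'' ∩ A^{p,q})`. -/
def kerd'd''Tot (k : ℤ) : Submodule ℂ W := ⨆ p : ℤ, C.kerd'd'' p (k - p)

/-- `Im d' ∩ A^k = ⊕_{p+q=k} (Im d' ∩ A^{p,q})`. -/
def imd'Tot (k : ℤ) : Submodule ℂ W := ⨆ p : ℤ, C.imd' p (k - p)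

/-- `Im d'' ∩ A^k = ⊕_{p+q=k} (Im d'' ∩ A^{p,q})`. -/
def imd''Tot (k : ℤ) : Submodule ℂ W := ⨆ p : ℤ, C.imd'' p (k - p)

/-- The double complex is totally bounded: `A^{p,q} = 0` for `|p| > N` or `|q| > N`. -/
def TotallyBounded : Prop :=
  ∃ N : ℕ, ∀ p q : ℤ, ((N : ℤ) < |p| ∨ (N : ℤ) < |q|) → C.A p q = ⊥

end BiComplex

/-- The quotient vector space `S / T` of a submodule `S` by (the trace of) a
submodule `T ≤ S`. -/
abbrev quotSub {W : Type*} [AddCommGroup W] [Module ℂ W] (S T : Submodule ℂ W) :=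
  S ⧸ (Submodule.comap S.subtype T)

namespace BiComplex

variable {W : Type*} [AddCommGroup W] [Module ℂ W] (C : BiComplex W)

lemma d'_d' (x : W) : C.d' (C.d' x) = 0 := LinearMap.congr_fun C.d'_sq x

lemma d''_d'' (x : W) : C.d'' (C.d'' x) = 0 := LinearMap.congr_fun C.d''_sq x

lemma d'_d'' (x : W) : C.d' (C.d'' x) = -C.d'' (C.d' x) :=
  eq_neg_of_add_eq_zero_left (LinearMap.congr_fun C.anticomm x)

lemma dtot_apply (x : W) : C.dtot x = C.d' x + C.d'' x := rfl

lemma dtot_dtot (x : W) : C.dtot (C.dtot x) = 0 := by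
  simp [dtot_apply, C.d'_d', C.d''_d'', C.d'_d'']

lemma d'_mem {p q : ℤ} {x : W} (hx : x ∈ C.A p q) : C.d' x ∈ C.A (p + 1) q :=
  C.map_d' p q (Submodule.mem_map_of_mem hx)

lemma d''_mem {p q : ℤ} {x : W} (hx : x ∈ C.A p q) : C.d'' x ∈ C.A p (q + 1) :=
  C.map_d'' p q (Submodule.mem_map_of_mem hx)

lemma le_Atot {p q k : ℤ} (h : p + q = k) : C.A p q ≤ C.Atot k := by
  obtain rfl : q = k - p := by lia
  exact le_iSup (fun p => C.A p (k - p)) p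

lemma imd'Tot_eq (k : ℤ) : C.imd'Tot k = (C.Atot (k - 1)).map C.d' := by
  rw [imd'Tot, Atot, Submodule.map_iSup,
    ← (Equiv.subRight (1 : ℤ)).iSup_comp (g := fun p => (C.A p (k - 1 - p)).map C.d')]
  refine iSup_congr fun p => ?_
  simp [imd']

lemma imd''Tot_eq (k : ℤ) : C.imd''Tot k = (C.Atot (k - 1)).map C.d'' := by
  rw [imd''Tot, Atot, Submodule.map_iSup]
  refine iSup_congr fun p => ?_
  rw [imd'', sub_right_comm]

lemma d'_mem_Atot {k : ℤ} {x : W} (hx : x ∈ C.Atot k) : C.d' x ∈ C.Atot (k + 1) := by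
  refine (iSup_le fun p y hy => ?_ : C.Atot k ≤ (C.Atot (k + 1)).comap C.d') hx
  exact C.le_Atot (by ring) (C.d'_mem hy)

lemma d''_mem_Atot {k : ℤ} {x : W} (hx : x ∈ C.Atot k) : C.d'' x ∈ C.Atot (k + 1) := by
  refine (iSup_le fun p y hy => ?_ : C.Atot k ≤ (C.Atot (k + 1)).comap C.d'') hx
  exact C.le_Atot (by ring) (C.d''_mem hy)

/-- Since `d'd''` is bihomogeneous, its kernel in `A^k` is the sum of its bigraded pieces. -/
lemma mem_kerd'd''Tot {k : ℤ} {x : W} (hx : x ∈ C.Atot k) (h : C.d' (C.d'' x) = 0) :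
    x ∈ C.kerd'd''Tot k := by
  obtain ⟨f, hf, rfl⟩ := (Submodule.mem_iSup_iff_exists_finsupp _ _).mp hx
  have hindep : iSupIndep fun p : ℤ => C.A (p + 1) (k - p + 1) :=
    C.internal.submodule_iSupIndep.comp (f := fun p : ℤ => (p + 1, k - p + 1))
      fun a b hab => by simpa using (Prod.ext_iff.mp hab).1
  have hzero := (iSupIndep_iff_finsetSum_eq_zero_imp_eq_zero _).mp hindep f.support
    (fun p => C.d' (C.d'' (f p))) (fun p _ => C.d'_mem (C.d''_mem (hf p)))
    (by simpa [Finsupp.sum] using h)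
  exact Submodule.sum_mem _ fun p hp =>
    Submodule.mem_iSup_of_mem (p := fun p => C.kerd'd'' p (k - p)) p ⟨hzero p hp, hf p⟩

/-- The endomorphism acting on `A^{p,q}` as multiplication by `p`. -/
noncomputable def firstDegree : W →ₗ[ℂ] W :=
  DirectSum.toModule ℂ (ℤ × ℤ) W (fun pq => (pq.1 : ℂ) • (C.A pq.1 pq.2).subtype) ∘ₗ
    (LinearEquiv.ofBijective (DirectSum.coeLinearMap fun pq : ℤ × ℤ => C.A pq.1 pq.2)
      C.internal).symm.toLinearMap

lemma firstDegree_apply {p q : ℤ} {x : W} (hx : x ∈ C.A p q) :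
    C.firstDegree x = (p : ℂ) • x := by
  have : (LinearEquiv.ofBijective (DirectSum.coeLinearMap fun pq : ℤ × ℤ => C.A pq.1 pq.2)
      C.internal).symm x =
      DirectSum.lof ℂ (ℤ × ℤ) (fun pq : ℤ × ℤ => C.A pq.1 pq.2) (p, q) ⟨x, hx⟩ := by
    rw [LinearEquiv.symm_apply_eq]
    exact (DirectSum.coeLinearMap_lof (fun pq : ℤ × ℤ => C.A pq.1 pq.2) (p, q) ⟨x, hx⟩).symm
  simp [firstDegree, this]

lemma firstDegree_mem_Atot {k : ℤ} {x : W} (hx : x ∈ C.Atot k) :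
    C.firstDegree x ∈ C.Atot k := by
  refine (iSup_le fun p y hy => ?_ : C.Atot k ≤ (C.Atot k).comap C.firstDegree) hx
  rw [Submodule.mem_comap, C.firstDegree_apply hy]
  exact Submodule.smul_mem _ _ (C.le_Atot (by ring) hy)

/-- The commutator of `d` with the first degree is `-d'`. -/
lemma dtot_firstDegree (x : W) :
    C.dtot (C.firstDegree x) = C.firstDegree (C.dtot x) - C.d' x := by
  have hx : x ∈ ⨆ pq : ℤ × ℤ, C.A pq.1 pq.2 := by
    rw [C.internal.submodule_iSup_eq_top]
    trivial
  refine (iSup_le fun pq y hy => ?_ : (⨆ pq : ℤ × ℤ, C.A pq.1 pq.2) ≤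
    LinearMap.eqLocus (C.dtot ∘ₗ C.firstDegree) (C.firstDegree ∘ₗ C.dtot - C.d')) hx
  simp only [LinearMap.mem_eqLocus, LinearMap.comp_apply, LinearMap.sub_apply, dtot_apply, map_add,
    C.firstDegree_apply hy, C.firstDegree_apply (C.d'_mem hy), C.firstDegree_apply (C.d''_mem hy),
    map_smul]
  push_cast
  module

lemma dtot_firstDegree_of_dtot_eq_zero {x : W} (hx : C.dtot x = 0) :
    C.dtot (C.firstDegree x) = C.d'' x := by
  rw [dtot_firstDegree, hx, map_zero, zero_sub, neg_eq_iff_add_eq_zero]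
  exact hx

end BiComplex

/-- Fix `k`.  If
`ker d'd'' ∩ A^k = (ker d + Im d' + Im d'') ∩ A^k` (i.e. the natural map
`H^k → ⊕_{p+q=k} H_A^{p,q}` is surjective), then
`ker d ∩ (Im d' + Im d'') ∩ A^{k+1} = Im d ∩ A^{k+1}` (i.e. the natural map
`H^{k+1} → ⊕_{p+q=k+1} H_A^{p,q}` is injective). -/
theorem bicomplex_psi_surj_implies_psi_inj
    {W : Type*} [AddCommGroup W] [Module ℂ W] (C : BiComplex W) (k : ℤ)
    (h : C.kerd'd''Tot k = C.kerdTot k ⊔ C.imd'Tot k ⊔ C.imd''Tot k) :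
    C.kerdTot (k + 1) ⊓ (C.imd'Tot (k + 1) ⊔ C.imd''Tot (k + 1)) =
      C.imdTot (k + 1) := by
  have hk : k + 1 - 1 = k := by ring
  rw [C.imd'Tot_eq (k + 1), C.imd''Tot_eq (k + 1), BiComplex.imdTot, hk]
  apply le_antisymm
  · rintro _ ⟨⟨hker, -⟩, hx⟩
    obtain ⟨_, ⟨a, ha, rfl⟩, _, ⟨b, hb, rfl⟩, rfl⟩ := Submodule.mem_sup.mp hx
    have hc : b - a ∈ C.kerd'd''Tot k := by
      refine C.mem_kerd'd''Tot (sub_mem hb ha) ?_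
      simpa [C.dtot_apply, C.d'_d', C.d''_d'', C.d'_d'', ← sub_eq_add_neg,
        sub_eq_zero, eq_comm] using hker
    rw [h, C.imd'Tot_eq, C.imd''Tot_eq] at hc
    obtain ⟨_, hzu, _, ⟨v, -, rfl⟩, hc⟩ := Submodule.mem_sup.mp hc
    obtain ⟨z, hz, _, ⟨u, hu, rfl⟩, rfl⟩ := Submodule.mem_sup.mp hzu
    have hd'u : C.d' u ∈ C.Atot k := by simpa using C.d'_mem_Atot hu
    refine ⟨a + C.firstDegree z + C.d' u,
      add_mem (add_mem ha (C.firstDegree_mem_Atot hz.2)) hd'u, ?_⟩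
    rw [map_add, map_add, C.dtot_firstDegree_of_dtot_eq_zero hz.1]
    obtain rfl : b = a + (z + C.d' u + C.d'' v) := by rw [hc]; abel
    simp only [C.dtot_apply, map_add, C.d'_d', C.d''_d'']
    abel
  · rintro _ ⟨w, hw, rfl⟩
    exact ⟨⟨C.dtot_dtot w, add_mem (C.d'_mem_Atot hw) (C.d''_mem_Atot hw)⟩,
      Submodule.add_mem_sup (Submodule.mem_map_of_mem hw) (Submodule.mem_map_of_mem hw)⟩
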